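/- (Identification of β.) Fix Q ≥ 2, K ≥ 1, T = 3, a true parameter θ⁰ = (β⁰, γ⁰, λ⁰) with λ⁰_1 < … < λ⁰_{Q−1}, and an initial outcome y_0 ∈ {1,…,Q}. For k ∈ {1,…,K} define 𝒳_{k,+} = {x ∈ (ℝ^K)^3 : x_{k,1} ≤ x_{k,3} < x_{k,2} or x_{k,1} < x_{k,3} ≤ x_{k,2}} and 𝒳_{k,−} = {x : x_{k,1} ≥ x_{k,3} > x_{k,2} or x_{k,1} > x_{k,3} ≥ x_{k,2}}, and for s ∈ {−,+}^K set 𝒳_s = ∩_{k=1}^K 𝒳_{k,s_k}. Let ν be a finite Borel measure on (ℝ^K)^3 × ℝ (the joint distribution of the regressors X and the finite-valued fixed effect A given Y_0 = y_0; mass at A = ±∞ may be omitted because the moment function below vanishes on the constant paths (1,1,1) and (Q,Q,Q)). Assume: (a) ν(𝒳_s × ℝ) > 0 for every s ∈ {−,+}^K with s_K = +; (b) for every β ∈ ℝ^K the functions x ↦ exp((x_2 − x_3)′β), x ↦ exp((x_3 − x_1)′β), x ↦ exp((x_2 − x_1)′β) are integrable with respect to the x-marginal of ν. For β ∈ ℝ^K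 define m_{y_0,1,1,1}(y, x, β, γ⁰) casewise by: exp((x_2 − x_3)′β) − 1 if y_1 = 1, y_2 = 1, y_3 > 1; −1 if y_1 = 1, y_2 > 1; exp((x_3 − x_1)′β + γ⁰_1 − γ⁰_{y_0}) if y_1 > 1, y_2 = 1, y_3 = 1; exp((x_2 − x_1)′β + γ⁰_{y_1} − γ⁰_{y_0}) if y_1 > 1, y_2 = 1, y_3 > 1; and 0 otherwise. If β ∈ ℝ^K satisfies ∫_{𝒳_s × ℝ} Σ_{y ∈ {1,…,Q}^3} m_{y_0,1,1,1}(y, x, β, γ⁰) · p_{y_0}(y, x, θ⁰, α) ν(dx, dα) = 0 for every s ∈ {−,+}^K with s_K = +, then β = β⁰. -/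

import Mathlib

open Finset MeasureTheory

/-- The logistic CDF `Λ(u) = 1/(1+exp(-u))`. -/
noncomputable def Lam (u : ℝ) : ℝ := 1 / (1 + Real.exp (-u))

/-- Probability that an ordered logit outcome with index `ζ` and thresholds
`lam` (categories `1,…,Q`, with the conventions `λ_0 = -∞`, `λ_Q = +∞`) equals `q`. -/
noncomputable def catProb (Q : ℕ) (lam : ℕ → ℝ) (ζ : ℝ) (q : ℕ) : ℝ :=
  (if q = 1 then 1 else Lam (ζ - lam (q - 1))) - (if q = Q then 0 else Lam (ζ - lam q))

/-- The set `𝒳_s = ∩_k 𝒳_{k,s_k}` of regressor values `x = (x_1, x_2, x_3)`;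
here `s k = true` encodes the sign `+` and `s k = false` the sign `−`. -/
def Xset (K : ℕ) (s : Fin K → Bool) :
    Set ((Fin K → ℝ) × (Fin K → ℝ) × (Fin K → ℝ)) :=
  {x | ∀ k : Fin K,
    if s k then
      (x.1 k ≤ x.2.2 k ∧ x.2.2 k < x.2.1 k) ∨ (x.1 k < x.2.2 k ∧ x.2.2 k ≤ x.2.1 k)
    else
      (x.2.1 k < x.2.2 k ∧ x.2.2 k ≤ x.1 k) ∨ (x.2.1 k ≤ x.2.2 k ∧ x.2.2 k < x.1 k)}


lemma lam_pos (u : ℝ) : 0 < Lam u := by unfold Lam; positivity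

lemma lam_lt_one (u : ℝ) : Lam u < 1 := by
  unfold Lam
  rw [div_lt_one (by positivity)]
  linarith [Real.exp_pos (-u)]

lemma lam_lt {u v : ℝ} (h : u < v) : Lam u < Lam v := by
  unfold Lam
  apply one_div_lt_one_div_of_lt (by positivity)
  have := Real.exp_lt_exp.2 (neg_lt_neg h)
  linarith

lemma lam_eq (u : ℝ) : Lam u = Real.exp u / (1 + Real.exp u) := by
  unfold Lam
  rw [Real.exp_neg]
  have := Real.exp_pos u
  field_simp
  ring

lemma catProb_pos (Q : ℕ) (hQ : 2 ≤ Q) (lam0 : ℕ → ℝ)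
    (hlam0 : ∀ q r : ℕ, 1 ≤ q → q < r → r ≤ Q - 1 → lam0 q < lam0 r)
    (z : ℝ) (q : ℕ) (hq : q ∈ Finset.Icc 1 Q) : 0 < catProb Q lam0 z q := by
  rw [Finset.mem_Icc] at hq
  unfold catProb
  by_cases h1 : q = 1
  · have : q ≠ Q := by omega
    rw [if_pos h1, if_neg this]
    linarith [lam_lt_one (z - lam0 q)]
  · rw [if_neg h1]
    by_cases h2 : q = Q
    · rw [if_pos h2]
      linarith [lam_pos (z - lam0 (q - 1))]
    · rw [if_neg h2]
      have := hlam0 (q - 1) q (by omega) (by omega) (by omega)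
      have := lam_lt (show z - lam0 q < z - lam0 (q - 1) by linarith)
      linarith

lemma catProb_le_one (Q : ℕ) (lam0 : ℕ → ℝ) (z : ℝ) (q : ℕ) : catProb Q lam0 z q ≤ 1 := by
  unfold catProb
  have h1 := lam_lt_one (z - lam0 (q - 1))
  have h2 := lam_pos (z - lam0 q)
  split_ifs <;> linarith

lemma catProb_one (Q : ℕ) (hQ : 2 ≤ Q) (lam0 : ℕ → ℝ) (z : ℝ) :
    catProb Q lam0 z 1 = 1 / (1 + Real.exp (z - lam0 1)) := by
  unfold catProb
  rw [if_pos rfl, if_neg (by omega), lam_eq]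
  have := Real.exp_pos (z - lam0 1)
  field_simp
  ring

lemma catProb_sum_aux (Q : ℕ) (lam0 : ℕ → ℝ) (z : ℝ) (n : ℕ) (hn : 2 ≤ n) :
    n ≤ Q → ∑ q ∈ Finset.Icc 2 n, catProb Q lam0 z q
      = Lam (z - lam0 1) - (if n = Q then 0 else Lam (z - lam0 n)) := by
  induction n, hn using Nat.le_induction with
  | base => intro _; simp [catProb]
  | succ n hn ih =>
    intro h
    rw [Finset.sum_Icc_succ_top (by omega), ih (by omega), if_neg (show n ≠ Q by omega)]
    unfold catProb
    rw [if_neg (show n + 1 ≠ 1 by omega)]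
    simp

lemma catProb_sum (Q : ℕ) (hQ : 2 ≤ Q) (lam0 : ℕ → ℝ) (z : ℝ) :
    ∑ q ∈ Finset.Icc 2 Q, catProb Q lam0 z q
      = Real.exp (z - lam0 1) / (1 + Real.exp (z - lam0 1)) := by
  rw [catProb_sum_aux Q lam0 z Q hQ le_rfl, if_pos rfl, sub_zero, lam_eq]

/-- The moment function with exponents `a`, `b`, `c`. -/
noncomputable def mm (γ0 : ℕ → ℝ) (y0 y1 y2 y3 : ℕ) (a b c : ℝ) : ℝ :=
  if y1 = 1 ∧ y2 = 1 ∧ 1 < y3 then Real.exp a - 1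
  else if y1 = 1 ∧ 1 < y2 then -1
  else if 1 < y1 ∧ y2 = 1 ∧ y3 = 1 then Real.exp (b + (γ0 1 - γ0 y0))
  else if 1 < y1 ∧ y2 = 1 ∧ 1 < y3 then Real.exp (c + (γ0 y1 - γ0 y0))
  else 0

/-- The conditional expectation of the moment function. -/
noncomputable def GG (Q : ℕ) (γ0 lam0 : ℕ → ℝ) (y0 : ℕ) (a b c u1 u2 u3 al : ℝ) : ℝ :=
  ∑ y1 ∈ Finset.Icc 1 Q, ∑ y2 ∈ Finset.Icc 1 Q, ∑ y3 ∈ Finset.Icc 1 Q,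
    mm γ0 y0 y1 y2 y3 a b c * (catProb Q lam0 (u1 + γ0 y0 + al) y1 *
            catProb Q lam0 (u2 + γ0 y1 + al) y2 *
            catProb Q lam0 (u3 + γ0 y2 + al) y3)

lemma mm_mono (γ0 : ℕ → ℝ) (y0 y1 y2 y3 : ℕ) {a b c a' b' c' : ℝ}
    (ha : a ≤ a') (hb : b ≤ b') (hc : c ≤ c') :
    mm γ0 y0 y1 y2 y3 a b c ≤ mm γ0 y0 y1 y2 y3 a' b' c' := by
  unfold mm
  split_ifs
  · linarith [Real.exp_le_exp.2 ha]
  · exact le_rfl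
  · exact Real.exp_le_exp.2 (by linarith)
  · exact Real.exp_le_exp.2 (by linarith)
  · exact le_rfl

lemma GG_strict (Q : ℕ) (hQ : 2 ≤ Q) (γ0 lam0 : ℕ → ℝ)
    (hlam0 : ∀ q r : ℕ, 1 ≤ q → q < r → r ≤ Q - 1 → lam0 q < lam0 r) (y0 : ℕ)
    {a b c a' b' c' : ℝ} (u1 u2 u3 al : ℝ)
    (ha : a ≤ a') (hb : b ≤ b') (hc : c < c') :
    GG Q γ0 lam0 y0 a b c u1 u2 u3 al < GG Q γ0 lam0 y0 a' b' c' u1 u2 u3 al := by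
  have hp := catProb_pos Q hQ lam0 hlam0
  have hle : ∀ y1 ∈ Finset.Icc 1 Q, ∀ y2 ∈ Finset.Icc 1 Q, ∀ y3 ∈ Finset.Icc 1 Q,
      mm γ0 y0 y1 y2 y3 a b c * (catProb Q lam0 (u1 + γ0 y0 + al) y1 *
            catProb Q lam0 (u2 + γ0 y1 + al) y2 * catProb Q lam0 (u3 + γ0 y2 + al) y3) ≤
      mm γ0 y0 y1 y2 y3 a' b' c' * (catProb Q lam0 (u1 + γ0 y0 + al) y1 *
            catProb Q lam0 (u2 + γ0 y1 + al) y2 * catProb Q lam0 (u3 + γ0 y2 + al) y3) := by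
    intro y1 h1 y2 h2 y3 h3
    apply mul_le_mul_of_nonneg_right (mm_mono γ0 y0 y1 y2 y3 ha hb hc.le)
    have := hp (u1 + γ0 y0 + al) y1 h1
    have := hp (u2 + γ0 y1 + al) y2 h2
    have := hp (u3 + γ0 y2 + al) y3 h3
    positivity
  have m1 : 1 ∈ Finset.Icc 1 Q := Finset.mem_Icc.2 (by omega)
  have m2 : 2 ∈ Finset.Icc 1 Q := Finset.mem_Icc.2 (by omega)
  unfold GG
  apply Finset.sum_lt_sum
  · intro y1 h1
    exact Finset.sum_le_sum fun y2 h2 => Finset.sum_le_sum fun y3 h3 => hle y1 h1 y2 h2 y3 h3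
  refine ⟨2, m2, ?_⟩
  apply Finset.sum_lt_sum
  · intro y2 h2
    exact Finset.sum_le_sum fun y3 h3 => hle 2 m2 y2 h2 y3 h3
  refine ⟨1, m1, ?_⟩
  apply Finset.sum_lt_sum
  · intro y3 h3
    exact hle 2 m2 1 m1 y3 h3
  refine ⟨2, m2, ?_⟩
  apply mul_lt_mul_of_pos_right
  · simp [mm, hc]
  · have := hp (u1 + γ0 y0 + al) 2 m2
    have := hp (u2 + γ0 2 + al) 1 m1
    have := hp (u3 + γ0 1 + al) 2 m2
    positivity

lemma sum_split (Q : ℕ) (hQ : 2 ≤ Q) (f : ℕ → ℝ) :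
    ∑ y ∈ Finset.Icc 1 Q, f y = f 1 + ∑ y ∈ Finset.Icc 2 Q, f y := by
  rw [← Finset.add_sum_Ioc_eq_sum_Icc (by omega : 1 ≤ Q)]
  rfl

lemma GG_zero (Q : ℕ) (hQ : 2 ≤ Q) (γ0 lam0 : ℕ → ℝ) (y0 : ℕ) (u1 u2 u3 al : ℝ) :
    GG Q γ0 lam0 y0 (u2 - u3) (u3 - u1) (u2 - u1) u1 u2 u3 al = 0 := by
  set e1 := Real.exp (u1 + γ0 y0 + al - lam0 1) with he1
  set e2 : ℕ → ℝ := fun q => Real.exp (u2 + γ0 q + al - lam0 1) with he2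
  set e3 := Real.exp (u3 + γ0 1 + al - lam0 1) with he3
  have p1 : 0 < e1 := Real.exp_pos _
  have p2 : ∀ q, 0 < e2 q := fun q => Real.exp_pos _
  have p3 : 0 < e3 := Real.exp_pos _
  have E1 : Real.exp (u2 - u3) = e2 1 / e3 := by
    rw [he2, he3, ← Real.exp_sub]; congr 1; ring
  have E2 : Real.exp (u3 - u1 + (γ0 1 - γ0 y0)) = e3 / e1 := by
    rw [he1, he3, ← Real.exp_sub]; congr 1; ring
  have E3 : ∀ q, Real.exp (u2 - u1 + (γ0 q - γ0 y0)) = e2 q / e1 := by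
    intro q
    rw [he1, he2, ← Real.exp_sub]; congr 1; ring
  -- inner sums
  have I11 : ∑ y3 ∈ Finset.Icc 1 Q,
      mm γ0 y0 1 1 y3 (u2 - u3) (u3 - u1) (u2 - u1) * (catProb Q lam0 (u1 + γ0 y0 + al) 1 *
            catProb Q lam0 (u2 + γ0 1 + al) 1 * catProb Q lam0 (u3 + γ0 1 + al) y3)
      = (e2 1 / e3 - 1) * (1 / (1 + e1) * (1 / (1 + e2 1)) * (e3 / (1 + e3))) := by
    rw [sum_split Q hQ, ← catProb_sum Q hQ, ← catProb_one Q hQ, ← catProb_one Q hQ,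
      Finset.mul_sum, Finset.mul_sum]
    have : mm γ0 y0 1 1 1 (u2 - u3) (u3 - u1) (u2 - u1) = 0 := by simp [mm]
    rw [this, zero_mul, zero_add]
    refine Finset.sum_congr rfl fun y hy => ?_
    have hy' : 1 < y := by have := (Finset.mem_Icc.1 hy).1; omega
    rw [← E1]
    simp [mm, hy']
  have S3 : ∀ z, ∑ y3 ∈ Finset.Icc 1 Q, catProb Q lam0 z y3 = 1 := by
    intro z
    rw [sum_split Q hQ, catProb_sum Q hQ, catProb_one Q hQ]
    have := Real.exp_pos (z - lam0 1)
    field_simp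
  have I12 : ∀ y2 ∈ Finset.Icc 2 Q, ∑ y3 ∈ Finset.Icc 1 Q,
      mm γ0 y0 1 y2 y3 (u2 - u3) (u3 - u1) (u2 - u1) * (catProb Q lam0 (u1 + γ0 y0 + al) 1 *
            catProb Q lam0 (u2 + γ0 1 + al) y2 * catProb Q lam0 (u3 + γ0 y2 + al) y3)
      = -(1 / (1 + e1)) * catProb Q lam0 (u2 + γ0 1 + al) y2 := by
    intro y2 hy
    have hy' : 1 < y2 := by have := (Finset.mem_Icc.1 hy).1; omega
    have hy'' : y2 ≠ 1 := by omega
    have : ∀ y3, mm γ0 y0 1 y2 y3 (u2 - u3) (u3 - u1) (u2 - u1) = -1 := by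
      intro y3; simp [mm, hy', hy'']
    simp only [this]
    rw [← Finset.mul_sum, ← Finset.mul_sum, S3, catProb_one Q hQ]
    ring
  have I21 : ∀ y1 ∈ Finset.Icc 2 Q, ∑ y3 ∈ Finset.Icc 1 Q,
      mm γ0 y0 y1 1 y3 (u2 - u3) (u3 - u1) (u2 - u1) * (catProb Q lam0 (u1 + γ0 y0 + al) y1 *
            catProb Q lam0 (u2 + γ0 y1 + al) 1 * catProb Q lam0 (u3 + γ0 1 + al) y3)
      = catProb Q lam0 (u1 + γ0 y0 + al) y1 * (e3 / ((1 + e3) * e1)) := by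
    intro y1 hy
    have hy' : 1 < y1 := by have := (Finset.mem_Icc.1 hy).1; omega
    have hy'' : y1 ≠ 1 := by omega
    have h1 : mm γ0 y0 y1 1 1 (u2 - u3) (u3 - u1) (u2 - u1) = e3 / e1 := by
      rw [← E2]; simp [mm, hy', hy'']
    have h2 : ∀ y3 ∈ Finset.Icc 2 Q,
        mm γ0 y0 y1 1 y3 (u2 - u3) (u3 - u1) (u2 - u1) * (catProb Q lam0 (u1 + γ0 y0 + al) y1 *
            catProb Q lam0 (u2 + γ0 y1 + al) 1 * catProb Q lam0 (u3 + γ0 1 + al) y3)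
        = e2 y1 / e1 * (catProb Q lam0 (u1 + γ0 y0 + al) y1 *
            catProb Q lam0 (u2 + γ0 y1 + al) 1) * catProb Q lam0 (u3 + γ0 1 + al) y3 := by
      intro y3 h3
      have h3' : 1 < y3 := by have := (Finset.mem_Icc.1 h3).1; omega
      have h3'' : y3 ≠ 1 := by omega
      have : mm γ0 y0 y1 1 y3 (u2 - u3) (u3 - u1) (u2 - u1) = e2 y1 / e1 := by
        rw [← E3]; simp [mm, hy', hy'', h3', h3'']
      rw [this]; ring
    rw [sum_split Q hQ, h1, Finset.sum_congr rfl h2, ← Finset.mul_sum, catProb_sum Q hQ,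
      catProb_one Q hQ (z := u2 + γ0 y1 + al), catProb_one Q hQ (z := u3 + γ0 1 + al)]
    change e3 / e1 * (catProb Q lam0 (u1 + γ0 y0 + al) y1 * (1 / (1 + e2 y1)) * (1 / (1 + e3)))
      + e2 y1 / e1 * (catProb Q lam0 (u1 + γ0 y0 + al) y1 * (1 / (1 + e2 y1)))
        * (e3 / (1 + e3)) = _
    have := p2 y1
    field_simp
  have I22 : ∀ y1 ∈ Finset.Icc 2 Q, ∀ y2 ∈ Finset.Icc 2 Q, ∑ y3 ∈ Finset.Icc 1 Q,
      mm γ0 y0 y1 y2 y3 (u2 - u3) (u3 - u1) (u2 - u1) * (catProb Q lam0 (u1 + γ0 y0 + al) y1 *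
            catProb Q lam0 (u2 + γ0 y1 + al) y2 * catProb Q lam0 (u3 + γ0 y2 + al) y3) = 0 := by
    intro y1 hy1 y2 hy2
    have h1 : y1 ≠ 1 := by have := (Finset.mem_Icc.1 hy1).1; omega
    have h2 : y2 ≠ 1 := by have := (Finset.mem_Icc.1 hy2).1; omega
    refine Finset.sum_eq_zero fun y3 _ => ?_
    simp [mm, h1, h2]
  unfold GG
  rw [sum_split Q hQ, sum_split Q hQ, I11, Finset.sum_congr rfl I12, ← Finset.mul_sum,
    catProb_sum Q hQ]
  have : ∀ y1 ∈ Finset.Icc 2 Q, (∑ y2 ∈ Finset.Icc 1 Q, ∑ y3 ∈ Finset.Icc 1 Q,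
      mm γ0 y0 y1 y2 y3 (u2 - u3) (u3 - u1) (u2 - u1) * (catProb Q lam0 (u1 + γ0 y0 + al) y1 *
            catProb Q lam0 (u2 + γ0 y1 + al) y2 * catProb Q lam0 (u3 + γ0 y2 + al) y3))
      = catProb Q lam0 (u1 + γ0 y0 + al) y1 * (e3 / ((1 + e3) * e1)) := by
    intro y1 hy1
    rw [sum_split Q hQ, I21 y1 hy1, Finset.sum_eq_zero (I22 y1 hy1), add_zero]
  rw [Finset.sum_congr rfl this, ← Finset.sum_mul, catProb_sum Q hQ]
  change (e2 1 / e3 - 1) * (1 / (1 + e1) * (1 / (1 + e2 1)) * (e3 / (1 + e3)))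
    + -(1 / (1 + e1)) * (e2 1 / (1 + e2 1)) + e1 / (1 + e1) * (e3 / ((1 + e3) * e1)) = 0
  have := p2 1
  field_simp
  ring

lemma measurable_catProb (Q : ℕ) (lam0 : ℕ → ℝ) (q : ℕ) :
    Measurable (fun z => catProb Q lam0 z q) := by
  unfold catProb Lam
  split_ifs <;> fun_prop

lemma measurableSet_Xset (K : ℕ) (s : Fin K → Bool) : MeasurableSet (Xset K s) := by
  unfold Xset
  rw [Set.ofPred_forall]
  refine MeasurableSet.iInter fun k => ?_
  have m1 : Measurable fun x : (Fin K → ℝ) × (Fin K → ℝ) × (Fin K → ℝ) => x.1 k := by fun_prop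
  have m2 : Measurable fun x : (Fin K → ℝ) × (Fin K → ℝ) × (Fin K → ℝ) => x.2.1 k := by fun_prop
  have m3 : Measurable fun x : (Fin K → ℝ) × (Fin K → ℝ) × (Fin K → ℝ) => x.2.2 k := by fun_prop
  cases s k
  · simp only [Bool.false_eq_true, if_false]
    exact ((measurableSet_lt m2 m3).inter (measurableSet_le m3 m1)).union
      ((measurableSet_le m2 m3).inter (measurableSet_lt m3 m1))
  · simp only [if_true]
    exact ((measurableSet_le m1 m3).inter (measurableSet_lt m3 m2)).union
      ((measurableSet_lt m1 m3).inter (measurableSet_le m3 m2))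

lemma integrable_mm {Ω : Type*} [MeasurableSpace Ω] (μ : Measure Ω) [IsFiniteMeasure μ]
    (γ0 : ℕ → ℝ) (y0 y1 y2 y3 : ℕ) (a b c : Ω → ℝ)
    (ha : Integrable (fun w => Real.exp (a w)) μ) (hb : Integrable (fun w => Real.exp (b w)) μ)
    (hc : Integrable (fun w => Real.exp (c w)) μ) :
    Integrable (fun w => mm γ0 y0 y1 y2 y3 (a w) (b w) (c w)) μ := by
  unfold mm
  simp only [Real.exp_add]
  split_ifs
  · exact ha.sub (integrable_const _)
  · exact integrable_const _
  · exact hb.mul_const _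
  · exact hc.mul_const _
  · exact integrable_const _

lemma integrable_GG {Ω : Type*} [MeasurableSpace Ω] (μ : Measure Ω) [IsFiniteMeasure μ]
    (Q : ℕ) (hQ : 2 ≤ Q) (γ0 lam0 : ℕ → ℝ)
    (hlam0 : ∀ q r : ℕ, 1 ≤ q → q < r → r ≤ Q - 1 → lam0 q < lam0 r) (y0 : ℕ)
    (a b c u1 u2 u3 al : Ω → ℝ)
    (ha : Integrable (fun w => Real.exp (a w)) μ) (hb : Integrable (fun w => Real.exp (b w)) μ)
    (hc : Integrable (fun w => Real.exp (c w)) μ)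
    (h1 : Measurable u1) (h2 : Measurable u2) (h3 : Measurable u3) (hal : Measurable al) :
    Integrable (fun w => GG Q γ0 lam0 y0 (a w) (b w) (c w) (u1 w) (u2 w) (u3 w) (al w)) μ := by
  unfold GG
  refine integrable_finsetSum _ fun y1 hy1 => integrable_finsetSum _ fun y2 hy2 =>
    integrable_finsetSum _ fun y3 hy3 => ?_
  refine (integrable_mm μ γ0 y0 y1 y2 y3 a b c ha hb hc).mul_bdd (c := 1) ?_ ?_
  · refine Measurable.aestronglyMeasurable ?_
    have := (measurable_catProb Q lam0 y1).comp ((h1.add_const (γ0 y0)).add hal)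
    have := (measurable_catProb Q lam0 y2).comp ((h2.add_const (γ0 y1)).add hal)
    have := (measurable_catProb Q lam0 y3).comp ((h3.add_const (γ0 y2)).add hal)
    refine Measurable.mul (Measurable.mul ?_ ?_) ?_ <;> assumption
  · refine Filter.Eventually.of_forall fun w => ?_
    have q1 := catProb_pos Q hQ lam0 hlam0 (u1 w + γ0 y0 + al w) y1 hy1
    have q2 := catProb_pos Q hQ lam0 hlam0 (u2 w + γ0 y1 + al w) y2 hy2
    have q3 := catProb_pos Q hQ lam0 hlam0 (u3 w + γ0 y2 + al w) y3 hy3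
    rw [Real.norm_of_nonneg (by positivity)]
    exact mul_le_one₀ (mul_le_one₀ (catProb_le_one _ _ _ _) q2.le (catProb_le_one _ _ _ _))
      q3.le (catProb_le_one _ _ _ _)

lemma setInt_pos {Ω : Type*} [MeasurableSpace Ω] (μ : Measure Ω) (S : Set Ω)
    (hS : MeasurableSet S) (hpos : 0 < μ S) (f : Ω → ℝ) (hf : Integrable f (μ.restrict S))
    (h : ∀ w ∈ S, 0 < f w) : 0 < ∫ w in S, f w ∂μ := by
  rw [setIntegral_pos_iff_support_of_nonneg_ae
    ((ae_restrict_iff' hS).2 (Filter.Eventually.of_forall fun w hw => (h w hw).le)) hf]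
  have hsub : S ⊆ Function.support f := fun w hw => (h w hw).ne'
  rwa [Set.inter_eq_self_of_subset_right hsub]

/-- Sign pattern facts for `Xset`. -/
lemma xset_signs (K : ℕ) (s : Fin K → Bool) (x : (Fin K → ℝ) × (Fin K → ℝ) × (Fin K → ℝ))
    (hx : x ∈ Xset K s) (β β' : Fin K → ℝ)
    (h : ∀ k, if s k then β k ≤ β' k else β' k ≤ β k) (hne : β ≠ β') :
    (∑ k, (x.2.1 k - x.2.2 k) * β k ≤ ∑ k, (x.2.1 k - x.2.2 k) * β' k) ∧
    (∑ k, (x.2.2 k - x.1 k) * β k ≤ ∑ k, (x.2.2 k - x.1 k) * β' k) ∧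
    (∑ k, (x.2.1 k - x.1 k) * β k < ∑ k, (x.2.1 k - x.1 k) * β' k) := by
  have key : ∀ k, (x.2.1 k - x.2.2 k) * β k ≤ (x.2.1 k - x.2.2 k) * β' k ∧
      (x.2.2 k - x.1 k) * β k ≤ (x.2.2 k - x.1 k) * β' k ∧
      (x.2.1 k - x.1 k) * β k ≤ (x.2.1 k - x.1 k) * β' k ∧
      (β k ≠ β' k → (x.2.1 k - x.1 k) * β k < (x.2.1 k - x.1 k) * β' k) := by
    intro k
    have hk := hx k
    have hb := h k
    cases hs : s k
    · simp only [hs, Bool.false_eq_true, if_false] at hk hb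
      have a1 : x.2.1 k - x.2.2 k ≤ 0 := by rcases hk with hk | hk <;> linarith [hk.1, hk.2]
      have a2 : x.2.2 k - x.1 k ≤ 0 := by rcases hk with hk | hk <;> linarith [hk.1, hk.2]
      have a3 : x.2.1 k - x.1 k < 0 := by rcases hk with hk | hk <;> linarith [hk.1, hk.2]
      exact ⟨mul_le_mul_of_nonpos_left hb a1, mul_le_mul_of_nonpos_left hb a2,
        mul_le_mul_of_nonpos_left hb a3.le,
        fun hn => mul_lt_mul_of_neg_left (lt_of_le_of_ne hb hn.symm) a3⟩
    · simp only [hs, if_true] at hk hb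
      have a1 : 0 ≤ x.2.1 k - x.2.2 k := by rcases hk with hk | hk <;> linarith [hk.1, hk.2]
      have a2 : 0 ≤ x.2.2 k - x.1 k := by rcases hk with hk | hk <;> linarith [hk.1, hk.2]
      have a3 : 0 < x.2.1 k - x.1 k := by rcases hk with hk | hk <;> linarith [hk.1, hk.2]
      exact ⟨mul_le_mul_of_nonneg_left hb a1, mul_le_mul_of_nonneg_left hb a2,
        mul_le_mul_of_nonneg_left hb a3.le,
        fun hn => mul_lt_mul_of_pos_left (lt_of_le_of_ne hb hn) a3⟩
  refine ⟨Finset.sum_le_sum fun k _ => (key k).1, Finset.sum_le_sum fun k _ => (key k).2.1, ?_⟩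
  obtain ⟨k, hk⟩ := Function.ne_iff.1 hne
  exact Finset.sum_lt_sum (fun k _ => (key k).2.2.1) ⟨k, Finset.mem_univ k, (key k).2.2.2 hk⟩

theorem statement11 (Q K : ℕ) (hQ : 2 ≤ Q) (hK : 1 ≤ K)
    (β0 : Fin K → ℝ) (γ0 lam0 : ℕ → ℝ)
    (hlam0 : ∀ q r : ℕ, 1 ≤ q → q < r → r ≤ Q - 1 → lam0 q < lam0 r)
    (y0 : ℕ) (hy0 : y0 ∈ Finset.Icc 1 Q)
    (ν : Measure (((Fin K → ℝ) × (Fin K → ℝ) × (Fin K → ℝ)) × ℝ))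
    [IsFiniteMeasure ν]
    (hpos : ∀ s : Fin K → Bool, s ⟨K - 1, by omega⟩ = true →
        0 < ν ((Xset K s) ×ˢ (Set.univ : Set ℝ)))
    (hint : ∀ β : Fin K → ℝ,
        Integrable (fun x : (Fin K → ℝ) × (Fin K → ℝ) × (Fin K → ℝ) =>
            Real.exp (∑ k, (x.2.1 k - x.2.2 k) * β k)) (ν.map Prod.fst) ∧
        Integrable (fun x : (Fin K → ℝ) × (Fin K → ℝ) × (Fin K → ℝ) =>
            Real.exp (∑ k, (x.2.2 k - x.1 k) * β k)) (ν.map Prod.fst) ∧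
        Integrable (fun x : (Fin K → ℝ) × (Fin K → ℝ) × (Fin K → ℝ) =>
            Real.exp (∑ k, (x.2.1 k - x.1 k) * β k)) (ν.map Prod.fst))
    (β : Fin K → ℝ)
    (hmom : ∀ s : Fin K → Bool, s ⟨K - 1, by omega⟩ = true →
      (∫ ω in (Xset K s) ×ˢ (Set.univ : Set ℝ),
        (∑ y1 ∈ Finset.Icc 1 Q, ∑ y2 ∈ Finset.Icc 1 Q, ∑ y3 ∈ Finset.Icc 1 Q,
          (if y1 = 1 ∧ y2 = 1 ∧ 1 < y3 then
              Real.exp (∑ k, (ω.1.2.1 k - ω.1.2.2 k) * β k) - 1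
            else if y1 = 1 ∧ 1 < y2 then -1
            else if 1 < y1 ∧ y2 = 1 ∧ y3 = 1 then
              Real.exp ((∑ k, (ω.1.2.2 k - ω.1.1 k) * β k) + (γ0 1 - γ0 y0))
            else if 1 < y1 ∧ y2 = 1 ∧ 1 < y3 then
              Real.exp ((∑ k, (ω.1.2.1 k - ω.1.1 k) * β k) + (γ0 y1 - γ0 y0))
            else 0) *
          (catProb Q lam0 ((∑ k, ω.1.1 k * β0 k) + γ0 y0 + ω.2) y1 *
            catProb Q lam0 ((∑ k, ω.1.2.1 k * β0 k) + γ0 y1 + ω.2) y2 *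
            catProb Q lam0 ((∑ k, ω.1.2.2 k * β0 k) + γ0 y2 + ω.2) y3)) ∂ν) = 0) :
    β = β0 := by
  by_contra hne
  set F : (Fin K → ℝ) → (((Fin K → ℝ) × (Fin K → ℝ) × (Fin K → ℝ)) × ℝ) → ℝ := fun b ω =>
    GG Q γ0 lam0 y0 (∑ k, (ω.1.2.1 k - ω.1.2.2 k) * b k) (∑ k, (ω.1.2.2 k - ω.1.1 k) * b k)
      (∑ k, (ω.1.2.1 k - ω.1.1 k) * b k) (∑ k, ω.1.1 k * β0 k) (∑ k, ω.1.2.1 k * β0 k)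
      (∑ k, ω.1.2.2 k * β0 k) ω.2 with hF
  have hF0 : ∀ ω, F β0 ω = 0 := by
    intro ω
    have := GG_zero Q hQ γ0 lam0 y0 (∑ k, ω.1.1 k * β0 k) (∑ k, ω.1.2.1 k * β0 k)
      (∑ k, ω.1.2.2 k * β0 k) ω.2
    simp only [hF, sub_mul, Finset.sum_sub_distrib]
    exact this
  have hmom' : ∀ s : Fin K → Bool, s ⟨K - 1, by omega⟩ = true →
      ∫ ω in (Xset K s) ×ˢ (Set.univ : Set ℝ), F β ω ∂ν = 0 := fun s hs => hmom s hs
  have hintF : Integrable (F β) ν := by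
    obtain ⟨i1, i2, i3⟩ := hint β
    exact integrable_GG ν Q hQ γ0 lam0 hlam0 y0 _ _ _ _ _ _ _
      (i1.comp_measurable measurable_fst) (i2.comp_measurable measurable_fst)
      (i3.comp_measurable measurable_fst) (by fun_prop) (by fun_prop) (by fun_prop)
      (by fun_prop)
  have hmeas : ∀ s, MeasurableSet ((Xset K s) ×ˢ (Set.univ : Set ℝ)) :=
    fun s => (measurableSet_Xset K s).prod MeasurableSet.univ
  rcases le_total (β0 ⟨K - 1, by omega⟩) (β ⟨K - 1, by omega⟩) with h | h
  · let s : Fin K → Bool := fun k => decide (β0 k ≤ β k)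
    have hs : s ⟨K - 1, by omega⟩ = true := by simpa [s] using h
    have hsg : ∀ k, if s k then β0 k ≤ β k else β k ≤ β0 k := by
      intro k
      by_cases hk : β0 k ≤ β k
      · simp [s, hk]
      · simp [s, hk, (not_le.1 hk).le]
    have := setInt_pos ν _ (hmeas s) (hpos s hs) (F β) hintF.restrict (by
      intro ω hω
      obtain ⟨a1, a2, a3⟩ := xset_signs K s ω.1 hω.1 β0 β hsg (Ne.symm hne)
      rw [← hF0 ω]
      exact GG_strict Q hQ γ0 lam0 hlam0 y0 _ _ _ _ a1 a2 a3)
    rw [hmom' s hs] at this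
    exact lt_irrefl _ this
  · let s : Fin K → Bool := fun k => decide (β k ≤ β0 k)
    have hs : s ⟨K - 1, by omega⟩ = true := by simpa [s] using h
    have hsg : ∀ k, if s k then β k ≤ β0 k else β0 k ≤ β k := by
      intro k
      by_cases hk : β k ≤ β0 k
      · simp [s, hk]
      · simp [s, hk, (not_le.1 hk).le]
    have := setInt_pos ν _ (hmeas s) (hpos s hs) (fun ω => - F β ω) hintF.neg.restrict (by
      intro ω hω
      obtain ⟨a1, a2, a3⟩ := xset_signs K s ω.1 hω.1 β β0 hsg hne
      rw [neg_pos, ← hF0 ω]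
      exact GG_strict Q hQ γ0 lam0 hlam0 y0 _ _ _ _ a1 a2 a3)
    rw [integral_neg, hmom' s hs] at this
    simp at this
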